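/- arXiv:2106.02234 — 2 statements merged into one kernel-verified Lean document; each statement's English description precedes it below -/
import Mathlib

section
/- Let (Ω, μ) be a probability space, let X, N : Ω → ℝ be independent measurable random variables, and suppose the characteristic function of the law of N is nowhere zero. Let h : ℝ → ℝ be measurable. If the random variable ω ↦ h(X(ω)) + N(ω) is independent of X (in the sense of IndepFun), then h∘X is almost surely constant: there exists c ∈ ℝ with h(X(ω)) = c for μ-almost every ω. -/
open MeasureTheory ProbabilityTheory

/-- If a real random variable `Y` is independent of itself, then it is almost surely constant. -/
theorem IndepFun.exists_ae_eq_const_of_self {Ω : Type*} [MeasurableSpace Ω] {μ : Measure Ω}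
    [IsProbabilityMeasure μ] {Y : Ω → ℝ} (hY : Measurable Y) (hYY : IndepFun Y Y μ) :
    ∃ c : ℝ, ∀ᵐ ω ∂μ, Y ω = c := by
  refine Filter.exists_eventuallyEq_const_of_forall_separating (l := ae μ) MeasurableSet ?_
  intro U hU
  rcases measure_eq_zero_or_one_of_indep_self (IndepFun_iff_Indep _ _ _ |>.1 hYY)
    (⟨U, hU, rfl⟩ : MeasurableSet[MeasurableSpace.comap Y inferInstance] (Y ⁻¹' U)) with h0 | h1
  · exact Or.inr (measure_eq_zero_iff_ae_notMem.1 h0)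
  · exact Or.inl ((prob_compl_eq_zero_iff (hY hU)).2 h1)

theorem indep_noisy_signal_implies_degenerate
    {Ω : Type*} [MeasurableSpace Ω] (μ : Measure Ω) [IsProbabilityMeasure μ]
    (X N : Ω → ℝ) (hX : Measurable X) (hN : Measurable N)
    (hIndep : IndepFun X N μ)
    (hchar : ∀ t : ℝ, ∫ x, Complex.exp (Complex.I * t * x) ∂(Measure.map N μ) ≠ 0)
    (h : ℝ → ℝ) (hh : Measurable h)
    (hres : IndepFun (fun ω => h (X ω) + N ω) X μ) :
    ∃ c : ℝ, ∀ᵐ ω ∂μ, h (X ω) = c := by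
  have hS : Measurable (fun ω => h (X ω)) := hh.comp hX
  refine IndepFun.exists_ae_eq_const_of_self hS ?_
  set e : ℝ → ℝ → ℂ := fun t x => Complex.exp (Complex.I * t * x) with he
  have hem (t : ℝ) : Measurable (e t) := by fun_prop
  have hadd (t x y : ℝ) : e t (x + y) = e t x * e t y := by
    simp only [he, ← Complex.exp_add]; push_cast; ring_nf
  have hmul (t s : ℝ) : ∫ ω, e t (h (X ω)) * e s (h (X ω)) ∂μ
      = (∫ ω, e t (h (X ω)) ∂μ) * ∫ ω, e s (h (X ω)) ∂μ := by
    have hNt : ∫ ω, e t (N ω) ∂μ ≠ 0 := by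
      rw [← integral_map hN.aemeasurable (hem t).aestronglyMeasurable]; exact hchar t
    have hXN (f : ℝ → ℂ) (hf : Measurable f) :
        ∫ ω, f (X ω) * e t (N ω) ∂μ = (∫ ω, f (X ω) ∂μ) * ∫ ω, e t (N ω) ∂μ :=
      hIndep.integral_fun_comp_mul_comp hX.aemeasurable hN.aemeasurable
        hf.aestronglyMeasurable (hem t).aestronglyMeasurable
    have h1 := hXN (fun x => e t (h x) * e s (h x)) (by fun_prop)
    have h2 := hXN (fun x => e t (h x)) (by fun_prop)
    have h3 : ∫ ω, e t (h (X ω) + N ω) * e s (h (X ω)) ∂μ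
        = (∫ ω, e t (h (X ω) + N ω) ∂μ) * ∫ ω, e s (h (X ω)) ∂μ :=
      hres.integral_fun_comp_mul_comp (g := fun x => e s (h x)) (hS.add hN).aemeasurable
        hX.aemeasurable (hem t).aestronglyMeasurable
        ((hem s).comp hh).aestronglyMeasurable
    simp only [hadd, h2] at h3
    apply mul_right_cancel₀ hNt
    rw [← h1, mul_right_comm, ← h3]
    exact integral_congr_ae (.of_forall fun ω => mul_right_comm _ _ _)
  have hchF (t : ℝ) : charFun (μ.map fun ω => h (X ω)) t = ∫ ω, e t (h (X ω)) ∂μ := by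
    rw [charFun_apply_real, integral_map hS.aemeasurable (by fun_prop)]
    exact integral_congr_ae (.of_forall fun ω => by simp only [he]; ring_nf)
  rw [indepFun_iff_charFun_prod hS.aemeasurable hS.aemeasurable]
  intro t
  rw [hchF, hchF, ← hmul, charFun_apply, integral_map (by fun_prop) (by fun_prop)]
  refine integral_congr_ae (.of_forall fun ω => ?_)
  simp only [he, ← Complex.exp_add, WithLp.prod_inner_apply]
  congr 1
  simp
  ring
end

section
/- Let (Ω, μ) be a probability space and let X, N : Ω → ℝ be independent random variables, each with law equal to the standard Gaussian measure on ℝ (mean 0, variance 1). Define x_i(ω) = X(ω)² + N(ω). Then for every measurable function g : ℝ → ℝ, the random variable ω ↦ X(ω) − g(x_i(ω)) is not independent of x_i (in the sense of IndepFun). -/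
open MeasureTheory ProbabilityTheory

namespace ProbabilityTheory

variable {Ω : Type*} [MeasurableSpace Ω] {μ : Measure Ω} [IsProbabilityMeasure μ]

/-- If a sum of two independent random variables is integrable, so is the first summand. -/
lemma IndepFun.integrable_left_of_integrable_add {R Z : Ω → ℝ} (hR : Measurable R)
    (hZ : Measurable Z) (h : IndepFun R Z μ) (hint : Integrable (fun ω => R ω + Z ω) μ) :
    Integrable R μ := by
  have := Measure.isProbabilityMeasure_map (μ := μ) hZ.aemeasurable
  have hprod : Integrable (fun p : ℝ × ℝ => p.1 + p.2) ((μ.map R).prod (μ.map Z)) := by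
    rw [← h.map_prod_eq_prod_map_map hR.aemeasurable hZ.aemeasurable]
    exact (integrable_map_measure (by fun_prop) (by fun_prop)).2 hint
  obtain ⟨z, hz⟩ := hprod.prod_left_ae.exists
  have := (integrable_map_measure (by fun_prop) (by fun_prop)).1 hz
  exact (this.sub (integrable_const z)).congr (.of_forall fun ω => by simp)

/-- If the law of `X` is symmetric and `N` is independent of `X`, then `X` has conditional
expectation zero given any function of the form `F X N` which is even in `X`. -/
lemma condExp_comap_eq_zero_of_even {X N : Ω → ℝ} (hX : Measurable X) (hN : Measurable N)
    (h : IndepFun X N μ) (hsymm : μ.map (fun ω => -X ω) = μ.map X) (hint : Integrable X μ)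
    {F : ℝ × ℝ → ℝ} (hF : Measurable F) (heven : ∀ x n, F (-x, n) = F (x, n)) :
    μ[X | MeasurableSpace.comap (fun ω => F (X ω, N ω)) inferInstance] =ᵐ[μ] 0 := by
  have hm := (hF.comp (hX.prodMk hN)).comap_le
  refine (ae_eq_condExp_of_forall_setIntegral_eq hm hint
    (fun s _ _ => integrableOn_zero) ?_ stronglyMeasurable_zero.aestronglyMeasurable).symm
  rintro _ ⟨A, hA, rfl⟩ -
  have hid : IdentDistrib (fun ω => (-X ω, N ω)) (fun ω => (X ω, N ω)) μ μ :=
    IdentDistrib.prodMk ⟨by fun_prop, by fun_prop, hsymm⟩ (.refl hN.aemeasurable)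
      (h.comp measurable_neg measurable_id) h
  have hG : Measurable (fun p : ℝ × ℝ => (F ⁻¹' A).indicator Prod.fst p) :=
    measurable_fst.indicator (hF hA)
  have hI := (hid.comp hG).integral_eq
  have hneg (ω : Ω) : (F ⁻¹' A).indicator Prod.fst (-X ω, N ω) =
      -(F ⁻¹' A).indicator Prod.fst (X ω, N ω) := by
    by_cases hω : F (X ω, N ω) ∈ A <;> simp [Set.indicator, heven, hω]
  simp only [Function.comp_def, hneg, integral_neg] at hI
  rw [← integral_indicator (f := X) (hm _ ⟨A, hA, rfl⟩)]
  have : ∫ ω, (F ⁻¹' A).indicator Prod.fst (X ω, N ω) ∂μ = 0 := by linarith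
  exact (integral_zero _ _).trans this.symm

/-- If `X - g(Y)` is independent of `Y` and `X` has conditional expectation zero given `Y`, then
`X` itself is independent of `Y`. -/
lemma IndepFun.of_sub_of_condExp_eq_zero {X Y : Ω → ℝ} (hX : Measurable X) (hY : Measurable Y)
    (hint : Integrable X μ)
    (hcond : μ[X | MeasurableSpace.comap Y inferInstance] =ᵐ[μ] 0)
    {g : ℝ → ℝ} (hg : Measurable g) (h : IndepFun (fun ω => X ω - g (Y ω)) Y μ) :
    IndepFun X Y μ := by
  have hR : Measurable (fun ω => X ω - g (Y ω)) := by fun_prop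
  have hRint : Integrable (fun ω => X ω - g (Y ω)) μ :=
    IndepFun.integrable_left_of_integrable_add hR (hg.comp hY) (h.comp measurable_id hg)
      (by simpa using hint)
  have hgint : Integrable (fun ω => g (Y ω)) μ := by
    exact (hint.sub hRint).congr (.of_forall fun ω => by simp)
  have hsub := condExp_sub hint hgint (MeasurableSpace.comap Y inferInstance)
  have hgcond := condExp_of_stronglyMeasurable hY.comap_le
    (hg.comp (comap_measurable Y)).stronglyMeasurable hgint
  have hRcond := condExp_indep_eq hR.comap_le hY.comap_le
    (comap_measurable (fun ω => X ω - g (Y ω))).stronglyMeasurable h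
  set c := ∫ ω, (X ω - g (Y ω)) ∂μ
  refine (h.comp (measurable_id.sub_const c) measurable_id).congr ?_ .rfl
  filter_upwards [hsub, hRcond, hcond] with ω h₁ h₂ h₃
  have h₄ : (μ[fun ω => g (Y ω) | MeasurableSpace.comap Y inferInstance]) ω = g (Y ω) :=
    congrFun hgcond ω
  have h₅ := h₁.symm.trans h₂
  simp only [Pi.sub_apply, Function.comp_apply, Pi.zero_apply] at *
  simp only [id]
  linarith

/-- If `U` and `V` are independent and `U` is independent of `U + V`, then `U` has variance
zero. -/
lemma variance_eq_zero_of_indepFun_add {U V : Ω → ℝ} (hU : MemLp U 2 μ) (hV : MemLp V 2 μ)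
    (h : IndepFun U V μ) (hadd : IndepFun U (U + V) μ) : Var[U; μ] = 0 := by
  have := hadd.covariance_eq_zero hU (hU.add hV)
  rwa [covariance_add_right hU hU hV, h.covariance_eq_zero hU hV, add_zero,
    covariance_self hU.aemeasurable] at this

end ProbabilityTheory

theorem anticausal_residual_not_indep
    {Ω : Type*} [MeasurableSpace Ω] (μ : Measure Ω) [IsProbabilityMeasure μ]
    (X N : Ω → ℝ) (hX : Measurable X) (hN : Measurable N)
    (hIndep : IndepFun X N μ)
    (hXlaw : Measure.map X μ = gaussianReal 0 1)
    (hNlaw : Measure.map N μ = gaussianReal 0 1)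
    (xi : Ω → ℝ) (hxi : ∀ ω, xi ω = X ω ^ 2 + N ω) :
    ∀ g : ℝ → ℝ, Measurable g →
      ¬ IndepFun (fun ω => X ω - g (xi ω)) xi μ := by
  intro g hg h
  obtain rfl : xi = fun ω => X ω ^ 2 + N ω := funext hxi
  have hmem {Z : Ω → ℝ} (hZ : Measurable Z) (hlaw : μ.map Z = gaussianReal 0 1) (p : NNReal) :
      MemLp Z p μ := by
    have := memLp_id_gaussianReal (μ := 0) (v := 1) p
    rw [← hlaw] at this
    exact (memLp_map_measure_iff (by fun_prop) hZ.aemeasurable).1 this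
  have hXint : Integrable X μ := memLp_one_iff_integrable.1 (by simpa using hmem hX hXlaw 1)
  have hsymm : μ.map (fun ω => -X ω) = μ.map X := by
    have := Measure.map_map (μ := μ) measurable_neg hX
    rw [Function.comp_def] at this
    rw [← this, hXlaw]
    simpa using gaussianReal_map_neg (μ := 0) (v := 1)
  have hcond := condExp_comap_eq_zero_of_even hX hN hIndep hsymm hXint
    (F := fun p => p.1 ^ 2 + p.2) (by fun_prop) (by simp)
  have hXY := IndepFun.of_sub_of_condExp_eq_zero hX (by fun_prop) hXint hcond hg h
  have hsq : Measurable fun x : ℝ => x ^ 2 := by fun_prop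
  have hU : MemLp (fun ω => X ω ^ 2) 2 μ := by
    rw [memLp_two_iff_integrable_sq (by fun_prop)]
    have := (hmem hX hXlaw 4).integrable_norm_pow (p := 4) (by norm_num)
    refine this.congr (.of_forall fun ω => ?_)
    simp only [Real.norm_eq_abs, ← pow_mul]
    exact (by decide : Even 4).pow_abs _
  have hvar := variance_eq_zero_of_indepFun_add hU (by simpa using hmem hN hNlaw 2)
    (hIndep.comp hsq measurable_id) (hXY.comp hsq measurable_id)
  have hae := ae_eq_integral_of_variance_eq_zero hU hvar
  set c := ∫ ω, X ω ^ 2 ∂μ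
  have hfin : {x : ℝ | x ^ 2 = c}.Finite := by
    refine (Set.toFinite {√c, -√c}).subset fun x (hx : x ^ 2 = c) => ?_
    have : √c = |x| := by rw [← hx, Real.sqrt_sq_eq_abs]
    rcases abs_choice x with hx | hx <;> simp [this, hx]
  have hnull : NullSingletonClass (gaussianReal 0 1) := nullSingletonClass_gaussianReal one_ne_zero
  have hae' : ∀ᵐ x ∂(gaussianReal 0 1), x ^ 2 = c := by
    rw [← hXlaw]
    exact (ae_map_iff hX.aemeasurable (hsq (measurableSet_singleton c))).2 hae
  have hne : ∀ᵐ x ∂(gaussianReal 0 1), ¬ x ^ 2 = c := by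
    rw [ae_iff]
    simpa using hfin.measure_zero (gaussianReal 0 1)
  obtain ⟨x, hx, hx'⟩ := (hae'.and hne).exists
  exact hx' hx
end
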